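/- Fix an integer n ≥ 1. Let f : S^n → ℝ^{2n+1} be a map (S^n the unit sphere in ℝ^{n+1}) for which there exist M > 0 and a C^1 map Ψ : ℝ^{2n+1} → ℝ^{n+1} with |DΨ(z)| ≤ M for all z ∈ ℝ^{2n+1} and Ψ(f(x)) = x for all x ∈ S^n ⊂ ℝ^{n+1}. Let F ∈ W^{1,n+1}(B^{n+1}, ℝ^{2n+1}) (B^{n+1} the unit ball in ℝ^{n+1}) be a map whose weak differential DF satisfies rank DF(x) ≤ n for almost every x ∈ B^{n+1}. Then there is no sequence of maps F_k : B^{n+1} → ℝ^{2n+1}, each C^1 up to the boundary, such that simultaneously: ‖F_k − F‖_{W^{1,n+1}(B^{n+1},ℝ^{2n+1})} → 0 as k → ∞, H^{n+1}({x ∈ B^{n+1} : F_k(x) ≠ F(x)}) → 0 as k → ∞, and F_k(x) = f(x) for all x ∈ S^n and all k. -/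

import Mathlib

open MeasureTheory Metric Set
noncomputable section

/-- `Euc d` is `ℝ^d` with the Euclidean metric. -/
abbrev Euc (d : ℕ) := EuclideanSpace ℝ (Fin d)

/-- The index of the coordinate `x_j` in `ℍⁿ = ℝ^{2n+1}`. -/
def xIdx (n : ℕ) (j : Fin n) : Fin (2*n+1) := ⟨2*(j:ℕ), by have := j.isLt; omega⟩

/-- The index of the coordinate `y_j` in `ℍⁿ = ℝ^{2n+1}`. -/
def yIdx (n : ℕ) (j : Fin n) : Fin (2*n+1) := ⟨2*(j:ℕ)+1, by have := j.isLt; omega⟩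

/-- The index of the coordinate `t` in `ℍⁿ = ℝ^{2n+1}`. -/
def tIdx (n : ℕ) : Fin (2*n+1) := ⟨2*n, by omega⟩

/-- `γ` is an absolutely continuous curve on `[a,b]` with a.e. derivative `g`
(each component is the integral of the corresponding component of `g`), which is
horizontal: the derivative of the `t`-component satisfies the contact condition. -/
def IsHorizontalWith (n : ℕ) (a b : ℝ) (γ g : ℝ → Euc (2*n+1)) : Prop :=
  (∀ i, IntervalIntegrable (fun s => g s i) volume a b) ∧
  (∀ i, ∀ x ∈ Set.Icc a b, γ x i = γ a i + ∫ s in a..x, g s i) ∧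
  (∀ᵐ s ∂(volume.restrict (Set.Icc a b)),
    g s (tIdx n) = 2 * ∑ j : Fin n,
      (γ s (yIdx n j) * g s (xIdx n j) - γ s (xIdx n j) * g s (yIdx n j)))

/-- The horizontal length of a horizontal curve with a.e. derivative `g`:
the Euclidean length of the projection to `ℝ^{2n}`. -/
def horizLength (n : ℕ) (a b : ℝ) (g : ℝ → Euc (2*n+1)) : ℝ :=
  ∫ s in a..b, Real.sqrt (∑ j : Fin n, ((g s (xIdx n j))^2 + (g s (yIdx n j))^2))

/-- The Carnot–Carathéodory distance on `ℍⁿ`. -/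
def ccDist (n : ℕ) (p q : Euc (2*n+1)) : ℝ :=
  sInf { ℓ : ℝ | ∃ a b γ g, a ≤ b ∧ IsHorizontalWith n a b γ g ∧
    γ a = p ∧ γ b = q ∧ ℓ = horizLength n a b g }

/-- `f` is `L`-Lipschitz on `Z` as a map into `ℍⁿ` with the Carnot–Carathéodory metric. -/
def LipschitzOnCC (m n : ℕ) (L : ℝ) (Z : Set (Euc m)) (f : Euc m → Euc (2*n+1)) : Prop :=
  ∀ x ∈ Z, ∀ y ∈ Z, ccDist n (f x) (f y) ≤ L * dist x y

/-- `v` represents the distributional partial derivative `∂u/∂x_k` on `Ω`. -/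
def IsWeakPartialDeriv (m : ℕ) (Ω : Set (Euc m)) (u : Euc m → ℝ) (k : Fin m)
    (v : Euc m → ℝ) : Prop :=
  ∀ φ : Euc m → ℝ, ContDiff ℝ (⊤ : ℕ∞) φ → HasCompactSupport φ → tsupport φ ⊆ Ω →
    ∫ x in Ω, u x * fderiv ℝ φ x (EuclideanSpace.single k 1) = - ∫ x in Ω, v x * φ x

/-- `u ∈ L^p(Ω)`. -/
def MemLpOn (m : ℕ) (p : ℝ) (Ω : Set (Euc m)) (u : Euc m → ℝ) : Prop :=
  MemLp u (ENNReal.ofReal p) (volume.restrict Ω)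

/-- `u ∈ W^{1,p}(Ω)` with weak partial derivatives `v k = ∂u/∂x_k ∈ L^p(Ω)`. -/
def MemW1pWith (m : ℕ) (p : ℝ) (Ω : Set (Euc m)) (u : Euc m → ℝ)
    (v : Fin m → Euc m → ℝ) : Prop :=
  MemLpOn m p Ω u ∧ ∀ k, MemLpOn m p Ω (v k) ∧ IsWeakPartialDeriv m Ω u k (v k)

/-- The weak contact equation holds a.e. on `Ω` for `F` with weak partial
derivatives `v i k = ∂F_i/∂x_k`. -/
def ContactAEOn (m n : ℕ) (Ω : Set (Euc m)) (F : Euc m → Euc (2*n+1))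
    (v : Fin (2*n+1) → Fin m → Euc m → ℝ) : Prop :=
  ∀ᵐ x ∂(volume.restrict Ω), ∀ k : Fin m,
    v (tIdx n) k x = 2 * ∑ j : Fin n,
      (F x (yIdx n j) * v (xIdx n j) k x - F x (xIdx n j) * v (yIdx n j) k x)

/-- `F ∈ W^{1,p}(Ω,ℍⁿ)` with weak partial derivatives `v`:
all components belong to `W^{1,p}(Ω)` and the weak contact equation holds a.e. -/
def MemW1pHeisWith (m n : ℕ) (p : ℝ) (Ω : Set (Euc m)) (F : Euc m → Euc (2*n+1))
    (v : Fin (2*n+1) → Fin m → Euc m → ℝ) : Prop :=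
  (∀ i, MemW1pWith m p Ω (fun x => F x i) (fun k => v i k)) ∧ ContactAEOn m n Ω F v

/-- Lagrange interpolation of the polynomial `t ↦ det (1 + t A)` at the value `t = 1`. -/
theorem det_one_add_eq_sum_nodes {E : Type*} [NormedAddCommGroup E] [NormedSpace ℝ E]
    [FiniteDimensional ℝ E] (s : Finset ℝ) (hs : Module.finrank ℝ E < s.card) :
    ∃ c : ℝ → ℝ, ∀ A : E →L[ℝ] E,
      (1 + A).det = ∑ t ∈ s, c t * (1 + t • A).det := by
  classical
  refine ⟨fun t => (Lagrange.basis s id t).eval 1, fun A => ?_⟩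
  let b := Module.finBasis ℝ E
  let N := LinearMap.toMatrix b b (A : E →ₗ[ℝ] E)
  let P : Polynomial ℝ :=
    ((Polynomial.X : Polynomial ℝ) • N.map Polynomial.C +
      (1 : Matrix _ _ ℝ).map Polynomial.C).det
  have hP : ∀ t : ℝ, P.eval t = (1 + t • A).det := by
    intro t
    have h1 : (1 + t • A).det = (1 + t • N).det := by
      change LinearMap.det ((1 + t • A : E →L[ℝ] E) : E →ₗ[ℝ] E) = _
      rw [← LinearMap.det_toMatrix b]
      congr 1
      simp [N, LinearMap.toMatrix_one]
    rw [h1]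
    change Polynomial.evalRingHom t P = _
    rw [RingHom.map_det]
    congr 1
    ext i j
    simp [Matrix.one_apply]
    split_ifs <;> simp <;> ring
  have hdeg : P.degree < (s.card : WithBot ℕ) := by
    have h1 : P.natDegree ≤ Module.finrank ℝ E := by
      have := Polynomial.natDegree_det_X_add_C_le N 1
      rwa [Fintype.card_fin] at this
    exact lt_of_le_of_lt Polynomial.degree_le_natDegree (by exact_mod_cast h1.trans_lt hs)
  have h2 := congrArg (Polynomial.eval 1)
    (Lagrange.eq_interpolate (s := s) (v := id) Function.injective_id.injOn hdeg)
  rw [Lagrange.interpolate_apply, Polynomial.eval_finsetSum] at h2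
  have h3 : (1 + A).det = P.eval 1 := by rw [hP, one_smul]
  rw [h3, h2]
  refine Finset.sum_congr rfl fun t _ => ?_
  simp only [id, Polynomial.eval_mul, Polynomial.eval_C, hP]
  ring

/-- A Lipschitz map on the closed unit ball vanishing on the sphere stays Lipschitz when
extended by zero. -/
theorem lipschitzWith_indicator_closedBall {E : Type*} [NormedAddCommGroup E] [NormedSpace ℝ E]
    {h : E → E} {K : NNReal} (hK : LipschitzOnWith K h (closedBall 0 1))
    (h0 : ∀ x ∈ sphere (0 : E) 1, h x = 0) :
    LipschitzWith K ((closedBall (0 : E) 1).indicator h) := by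
  have key : ∀ x ∈ closedBall (0 : E) 1, ∀ y ∉ closedBall (0 : E) 1,
      dist (h x) 0 ≤ K * dist x y := by
    intro x hx y hy
    have hx' : ‖x‖ ≤ 1 := by simpa using hx
    have hy' : 1 ≤ ‖y‖ := by
      rw [mem_closedBall_zero_iff, not_le] at hy
      exact hy.le
    obtain ⟨z, hz, hz1⟩ := (convex_segment x y).isPreconnected.intermediate_value
      (left_mem_segment ℝ x y) (right_mem_segment ℝ x y) continuous_norm.continuousOn
      (⟨hx', hy'⟩ : (1 : ℝ) ∈ Icc ‖x‖ ‖y‖)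
    have hz' : z ∈ sphere (0 : E) 1 := by simpa using hz1
    have h1 := hK.dist_le_mul x hx z (sphere_subset_closedBall hz')
    rw [h0 z hz'] at h1
    refine h1.trans (mul_le_mul_of_nonneg_left ?_ K.2)
    have := dist_add_dist_of_mem_segment hz
    linarith [dist_nonneg (x := z) (y := y)]
  refine LipschitzWith.of_dist_le_mul fun x y => ?_
  by_cases hx : x ∈ closedBall (0 : E) 1 <;> by_cases hy : y ∈ closedBall (0 : E) 1
  · simpa only [indicator_of_mem hx, indicator_of_mem hy] using hK.dist_le_mul x hx y hy
  · simpa only [indicator_of_mem hx, indicator_of_notMem hy] using key x hx y hy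
  · rw [indicator_of_notMem hx, indicator_of_mem hy, dist_comm, dist_comm x]
    exact key y hy x hx
  · simp only [indicator_of_notMem hx, indicator_of_notMem hy, dist_self]
    positivity

/-- A perturbation of the identity by a contraction supported in the closed unit ball maps the
open unit ball bijectively onto itself. -/
theorem bijOn_ball_add_of_lipschitz {E : Type*} [NormedAddCommGroup E] [NormedSpace ℝ E]
    [CompleteSpace E] {H : E → E} {c : NNReal} (hc : c < 1) (hH : LipschitzWith c H)
    (h0 : ∀ x ∉ ball (0 : E) 1, H x = 0) :
    BijOn (fun x => x + H x) (ball (0 : E) 1) (ball (0 : E) 1) := by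
  have happ : ApproximatesLinearOn (fun x => x + H x)
      ((ContinuousLinearEquiv.refl ℝ E : E ≃L[ℝ] E) : E →L[ℝ] E) univ c := by
    intro x _ y _
    have := hH.dist_le_mul x y
    rw [dist_eq_norm, dist_eq_norm] at this
    change ‖x + H x - (y + H y) - (x - y)‖ ≤ _
    rwa [show x + H x - (y + H y) - (x - y) = H x - H y by abel]
  have hN : Subsingleton E ∨
      c < ‖((ContinuousLinearEquiv.refl ℝ E : E ≃L[ℝ] E).symm : E →L[ℝ] E)‖₊⁻¹ := by
    rcases subsingleton_or_nontrivial E with h | h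
    · exact Or.inl h
    · right
      have : ‖((ContinuousLinearEquiv.refl ℝ E : E ≃L[ℝ] E).symm : E →L[ℝ] E)‖₊ = 1 := by
        ext
        exact ContinuousLinearMap.norm_id
      rwa [this, inv_one]
  have hinj : Function.Injective (fun x => x + H x) :=
    injOn_univ.1 (happ.injOn hN)
  have hsurj := happ.surjective hN
  have hfix : ∀ x ∉ ball (0 : E) 1, x + H x = x := fun x hx => by rw [h0 x hx, add_zero]
  refine ⟨fun x hx => ?_, hinj.injOn, fun y hy => ?_⟩
  · by_contra hcon
    have := hinj (hfix _ hcon)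
    exact hcon (by rw [this]; exact hx)
  · obtain ⟨x, rfl⟩ := hsurj y
    by_cases hx : x ∈ ball (0 : E) 1
    · exact ⟨x, hx, rfl⟩
    · exact absurd (by simpa [hfix x hx] using hy) hx

/-- If `h` is `C¹` on the closed unit ball and vanishes on the unit sphere, then the integral of
the Jacobian determinant of `id + h` over the ball is the volume of the ball. -/
theorem integral_det_one_add_fderiv_eq_volume_ball {E : Type*} [NormedAddCommGroup E]
    [NormedSpace ℝ E] [FiniteDimensional ℝ E] [MeasurableSpace E] [BorelSpace E]
    (μ : Measure E) [μ.IsAddHaarMeasure] {h : E → E}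
    (hC : ContDiffOn ℝ 1 h (closedBall 0 1)) (h0 : ∀ x ∈ sphere (0 : E) 1, h x = 0) :
    ∫ x in ball (0 : E) 1, (1 + fderiv ℝ h x).det ∂μ = μ.real (ball (0 : E) 1) := by
  have : CompleteSpace E := FiniteDimensional.complete ℝ E
  have : ProperSpace E := FiniteDimensional.proper_real E
  obtain ⟨K, hK⟩ := hC.exists_lipschitzOnWith one_ne_zero (convex_closedBall 0 1)
    (isCompact_closedBall 0 1)
  have hH := lipschitzWith_indicator_closedBall hK h0
  set H := (closedBall (0 : E) 1).indicator h with hHdef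
  have hH0 : ∀ x ∉ ball (0 : E) 1, H x = 0 := by
    intro x hx
    by_cases hx' : x ∈ closedBall (0 : E) 1
    · rw [hHdef, indicator_of_mem hx']
      refine h0 x ?_
      simp only [mem_ball, mem_closedBall, mem_sphere, not_lt] at *
      exact le_antisymm hx' hx
    · exact indicator_of_notMem hx' _
  have hHh : ∀ x ∈ ball (0 : E) 1, HasFDerivAt h (fderiv ℝ h x) x := fun x hx =>
    ((hC.contDiffAt (mem_nhds_iff.2 ⟨ball 0 1, ball_subset_closedBall, isOpen_ball, hx⟩)
      ).differentiableAt one_ne_zero).hasFDerivAt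
  have hnorm : ∀ x ∈ ball (0 : E) 1, ‖fderiv ℝ h x‖ ≤ K := fun x hx =>
    norm_fderiv_le_of_lipschitzOn ℝ
      (mem_nhds_iff.2 ⟨ball 0 1, ball_subset_closedBall, isOpen_ball, hx⟩) hK
  obtain ⟨ε, hε, hdet⟩ : ∃ ε > 0, ∀ A : E →L[ℝ] E, ‖A‖ < ε → 0 < (1 + A).det := by
    have hcont : Continuous fun A : E →L[ℝ] E => (1 + A).det :=
      ContinuousLinearMap.continuous_det.comp (continuous_const.add continuous_id)
    have h1 : (0 : ℝ) < (1 + (0 : E →L[ℝ] E)).det := by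
      rw [add_zero]
      change 0 < LinearMap.det (LinearMap.id : E →ₗ[ℝ] E)
      simp
    obtain ⟨ε, hε, h⟩ := Metric.mem_nhds_iff.1 (hcont.continuousAt.eventually (lt_mem_nhds h1))
    exact ⟨ε, hε, fun A hA => h (by simpa using hA)⟩
  set δ : ℝ := min ε 1 / (K + 1) with hδ
  have hK1 : (0 : ℝ) < K + 1 := by positivity
  have hδ0 : 0 < δ := by positivity
  have hsmall : ∀ t ∈ Ioo 0 δ, t * K < min ε 1 := by
    intro t ht
    have := (lt_div_iff₀ hK1).1 ht.2
    nlinarith [ht.1]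
  have hbase : ∀ t ∈ Ioo 0 δ,
      IntegrableOn (fun x => (1 + t • fderiv ℝ h x).det) (ball (0 : E) 1) μ ∧
      ∫ x in ball (0 : E) 1, (1 + t • fderiv ℝ h x).det ∂μ = μ.real (ball (0 : E) 1) := by
    intro t ht
    have hlip : LipschitzWith (‖t‖₊ * K) (fun x => t • H x) := (lipschitzWith_smul t).comp hH
    have hbij := bijOn_ball_add_of_lipschitz
      (by
        rw [← NNReal.coe_lt_coe, NNReal.coe_mul, coe_nnnorm, Real.norm_of_nonneg ht.1.le]
        exact (hsmall t ht).trans_le (min_le_right _ _)) hlip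
      (fun x hx => by rw [hH0 x hx, smul_zero])
    have hder : ∀ x ∈ ball (0 : E) 1, HasFDerivWithinAt (fun x => x + t • H x)
        (1 + t • fderiv ℝ h x) (ball 0 1) x := by
      intro x hx
      refine HasFDerivWithinAt.congr
        ((hasFDerivAt_id x).add ((hHh x hx).const_smul t)).hasFDerivWithinAt ?_ ?_
      · intro y hy
        simp [hHdef, indicator_of_mem (ball_subset_closedBall hy)]
      · simp [hHdef, indicator_of_mem (ball_subset_closedBall hx)]
    have habs : EqOn (fun x => |(1 + t • fderiv ℝ h x).det| • (1 : ℝ))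
        (fun x => (1 + t • fderiv ℝ h x).det) (ball 0 1) := by
      intro x hx
      have : ‖t • fderiv ℝ h x‖ < ε := by
        rw [norm_smul, Real.norm_of_nonneg ht.1.le]
        exact (mul_le_mul_of_nonneg_left (hnorm x hx) ht.1.le).trans_lt
          ((hsmall t ht).trans_le (min_le_left _ _))
      simp [abs_of_pos (hdet _ this)]
    have h1 := integrableOn_image_iff_integrableOn_abs_det_fderiv_smul μ measurableSet_ball hder
      hbij.injOn (fun _ => (1 : ℝ))
    have h2 := integral_image_eq_integral_abs_det_fderiv_smul μ measurableSet_ball hder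
      hbij.injOn (fun _ => (1 : ℝ))
    rw [hbij.image_eq] at h1 h2
    refine ⟨(integrableOn_congr_fun habs measurableSet_ball).1
      (h1.1 (integrableOn_const measure_ball_lt_top.ne)), ?_⟩
    rw [← setIntegral_congr_fun measurableSet_ball habs, ← h2]
    simp
  obtain ⟨s, hs, hcard⟩ := (Ioo_infinite hδ0).exists_subset_card_eq (Module.finrank ℝ E + 1)
  obtain ⟨c, hc⟩ := det_one_add_eq_sum_nodes (E := E) s (by omega)
  have hc1 : ∑ t ∈ s, c t = 1 := by
    have h1 : ((1 : E →L[ℝ] E)).det = 1 := LinearMap.det_id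
    simpa [h1] using (hc 0).symm
  rw [funext fun x => hc (fderiv ℝ h x)]
  rw [integral_finsetSum _ fun t ht => ((hbase t (hs ht)).1).const_mul (c t)]
  simp_rw [integral_const_mul]
  rw [Finset.sum_congr rfl fun t ht => by rw [(hbase t (hs ht)).2], ← Finset.sum_mul, hc1, one_mul]

/-- Lipschitz-type bound for the determinant of `A * B` near a matrix `V` of deficient rank. -/
theorem exists_abs_det_mul_le_of_rank_le (n m : ℕ) {M : ℝ} (hM : 0 ≤ M) :
    ∃ C : ℝ, 0 ≤ C ∧ ∀ (A : Matrix (Fin (n + 1)) (Fin m) ℝ) (B V : Matrix (Fin m) (Fin (n + 1)) ℝ),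
      (∀ i k, |A i k| ≤ M) → V.rank ≤ n →
      |(A * B).det| ≤ C * ((∑ i, ∑ k, |B i k - V i k|) *
        ((∑ i, ∑ k, |B i k - V i k|) + ∑ i, ∑ k, |V i k|) ^ n) := by
  let D := (Matrix.detRowAlternating : (Fin (n + 1) → ℝ) [⋀^Fin (n + 1)]→ₗ[ℝ] ℝ).toMultilinearMap
  have hDc : Continuous D := by
    change Continuous fun X : Matrix (Fin (n + 1)) (Fin (n + 1)) ℝ => X.det
    exact continuous_id.matrix_det
  obtain ⟨C, hC, hbound⟩ := D.exists_bound_of_continuous hDc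
  refine ⟨C * (n + 1) * M ^ n * M, by positivity, fun A B V hA hV => ?_⟩
  have hdetV : (A * V).det = 0 := by
    by_contra hne
    have h1 := Matrix.rank_of_isUnit (A * V)
      ((Matrix.isUnit_iff_isUnit_det _).2 (isUnit_iff_ne_zero.2 hne))
    have h2 := Matrix.rank_mul_le_right A V
    simp at h1
    omega
  have hmul : ∀ X : Matrix (Fin m) (Fin (n + 1)) ℝ,
      ‖(fun i k => (A * X) i k : Fin (n + 1) → Fin (n + 1) → ℝ)‖ ≤ M * ∑ i, ∑ k, |X i k| := by
    intro X
    have h0 : 0 ≤ M * ∑ i, ∑ k, |X i k| := by positivity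
    refine (pi_norm_le_iff_of_nonneg h0).2 fun i => (pi_norm_le_iff_of_nonneg h0).2 fun k => ?_
    rw [Real.norm_eq_abs, Matrix.mul_apply, Finset.mul_sum]
    refine (Finset.abs_sum_le_sum_abs _ _).trans (Finset.sum_le_sum fun j _ => ?_)
    rw [abs_mul]
    exact mul_le_mul (hA i j)
      (Finset.single_le_sum (f := fun k => |X j k|) (fun _ _ => abs_nonneg _) (Finset.mem_univ k))
      (abs_nonneg _) hM
  have hB : ∑ i, ∑ k, |B i k| ≤ (∑ i, ∑ k, |B i k - V i k|) + ∑ i, ∑ k, |V i k| := by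
    simp_rw [← Finset.sum_add_distrib]
    gcongr with i _ k _
    simpa using abs_add_le (B i k - V i k) (V i k)
  have hd0 : 0 ≤ ∑ i, ∑ k, |B i k - V i k| := by positivity
  have key := D.norm_image_sub_le_of_bound hC.le hbound (fun i k => (A * B) i k)
    (fun i k => (A * V) i k)
  have hDB : D (fun i k => (A * B) i k) = (A * B).det := rfl
  have hDV : D (fun i k => (A * V) i k) = (A * V).det := rfl
  rw [hDB, hDV, hdetV, sub_zero, Real.norm_eq_abs, Fintype.card_fin] at key
  have hsub : ‖(fun i k => (A * B) i k : Fin (n + 1) → Fin (n + 1) → ℝ) -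
      (fun i k => (A * V) i k)‖ ≤ M * ∑ i, ∑ k, |B i k - V i k| := by
    have := hmul (B - V)
    rw [Matrix.mul_sub] at this
    exact this
  have hmax := max_le ((hmul B).trans (mul_le_mul_of_nonneg_left hB hM))
    ((hmul V).trans (mul_le_mul_of_nonneg_left (le_add_of_nonneg_left hd0) hM))
  calc |(A * B).det| ≤ _ := key
    _ ≤ C * ((n + 1 : ℕ) : ℝ) *
        (M * ((∑ i, ∑ k, |B i k - V i k|) + ∑ i, ∑ k, |V i k|)) ^ n *
        (M * ∑ i, ∑ k, |B i k - V i k|) := by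
      simp only [Nat.add_sub_cancel]
      gcongr
    _ = _ := by push_cast; rw [mul_pow]; ring

/-- Hölder's inequality for products `d * g ^ n` in terms of `L^{n+1}` norms. -/
theorem lintegral_enorm_mul_pow_le {α : Type*} [MeasurableSpace α] {μ : Measure α} {n : ℕ}
    (hn : 1 ≤ n) {d g : α → ℝ} (hd : AEStronglyMeasurable d μ) (hg : AEStronglyMeasurable g μ) :
    ∫⁻ x, ‖d x‖ₑ * ‖g x‖ₑ ^ n ∂μ ≤
      eLpNorm d (ENNReal.ofReal ((n : ℝ) + 1)) μ *
        eLpNorm g (ENNReal.ofReal ((n : ℝ) + 1)) μ ^ n := by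
  have hn0 : (0 : ℝ) < n := by exact_mod_cast hn
  have hn1 : (0 : ℝ) < (n : ℝ) + 1 := by positivity
  have hpq : ((n : ℝ) + 1).HolderConjugate (((n : ℝ) + 1) / n) := by
    rw [Real.holderConjugate_iff]
    refine ⟨by linarith, ?_⟩
    field_simp
    ring
  have h := ENNReal.lintegral_mul_le_Lp_mul_Lq μ hpq hd.enorm (hg.enorm.pow_const n)
  have hp0 : ENNReal.ofReal ((n : ℝ) + 1) ≠ 0 := by simpa using hn1
  rw [eLpNorm_eq_lintegral_rpow_enorm_toReal hp0 ENNReal.ofReal_ne_top,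
    eLpNorm_eq_lintegral_rpow_enorm_toReal hp0 ENNReal.ofReal_ne_top,
    ENNReal.toReal_ofReal hn1.le]
  refine h.trans_eq ?_
  congr 1
  rw [← ENNReal.rpow_mul_natCast]
  have he : ∀ x, (‖g x‖ₑ ^ n) ^ (((n : ℝ) + 1) / n) = ‖g x‖ₑ ^ ((n : ℝ) + 1) := by
    intro x
    rw [← ENNReal.rpow_natCast_mul]
    congr 1
    field_simp
  simp_rw [he]
  congr 1
  field_simp

/-- Finite sums of absolute values of `L^p`-null sequences are `L^p`-null. -/
theorem tendsto_eLpNorm_sum_abs_zero {α ι : Type*} [Fintype ι] [MeasurableSpace α]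
    {μ : Measure α} {p : ENNReal} (hp : 1 ≤ p) {g : ℕ → ι → α → ℝ}
    (hm : ∀ j i, AEStronglyMeasurable (g j i) μ)
    (h : ∀ i, Filter.Tendsto (fun j => eLpNorm (g j i) p μ) Filter.atTop (nhds 0)) :
    Filter.Tendsto (fun j => eLpNorm (fun x => ∑ i, |g j i x|) p μ) Filter.atTop (nhds 0) := by
  have hsum : Filter.Tendsto (fun j => ∑ i, eLpNorm (g j i) p μ) Filter.atTop (nhds 0) := by
    simpa using tendsto_finsetSum Finset.univ fun i _ => h i
  refine tendsto_of_tendsto_of_tendsto_of_le_of_le tendsto_const_nhds hsum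
    (fun _ => bot_le) fun j => ?_
  have h1 := eLpNorm_sum_le (μ := μ) (p := p) (s := Finset.univ)
    (f := fun i x => ‖g j i x‖) (fun i _ => (hm j i).norm) hp
  simp_rw [eLpNorm_norm] at h1
  have h2 : (fun x => ∑ i, |g j i x|) = ∑ i, fun x => ‖g j i x‖ := by
    ext x
    simp
  simpa only [h2] using h1

/-- The Jacobian determinant of `Ψ ∘ Φ` as the determinant of a product of matrices, the second
factor consisting of the partial derivatives of the components of `Φ`. -/
theorem exists_det_fderiv_comp_eq_det_mul {n m : ℕ} {M : ℝ} {Ψ : Euc m → Euc (n + 1)}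
    {Φ : Euc (n + 1) → Euc m} {x : Euc (n + 1)} (hΨ : DifferentiableAt ℝ Ψ (Φ x))
    (hΨM : ‖fderiv ℝ Ψ (Φ x)‖ ≤ M) (hΦ : ∀ i, DifferentiableAt ℝ (fun y => Φ y i) x) :
    ∃ A : Matrix (Fin (n + 1)) (Fin m) ℝ, (∀ i k, |A i k| ≤ M) ∧
      (fderiv ℝ (Ψ ∘ Φ) x).det = (A * Matrix.of fun (i : Fin m) (k : Fin (n + 1)) =>
        fderiv ℝ (fun y => Φ y i) x (EuclideanSpace.single k 1)).det := by
  let e := (EuclideanSpace.basisFun (Fin (n + 1)) ℝ).toBasis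
  let e' := (EuclideanSpace.basisFun (Fin m) ℝ).toBasis
  have hΦ' : DifferentiableAt ℝ Φ x := differentiableAt_euclidean.2 hΦ
  refine ⟨LinearMap.toMatrix e' e (fderiv ℝ Ψ (Φ x) : Euc m →ₗ[ℝ] Euc (n + 1)),
    fun i k => ?_, ?_⟩
  · have h1 : LinearMap.toMatrix e' e (fderiv ℝ Ψ (Φ x) : Euc m →ₗ[ℝ] Euc (n + 1)) i k =
        fderiv ℝ Ψ (Φ x) (EuclideanSpace.single k 1) i := by
      simp [LinearMap.toMatrix_apply, e, e']
    rw [h1, ← Real.norm_eq_abs]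
    refine (PiLp.norm_apply_le _ i).trans
      (((fderiv ℝ Ψ (Φ x)).le_opNorm _).trans ?_)
    simpa using hΨM
  · have h2 : (Matrix.of fun (i : Fin m) (k : Fin (n + 1)) =>
        fderiv ℝ (fun y => Φ y i) x (EuclideanSpace.single k 1)) =
        LinearMap.toMatrix e e' (fderiv ℝ Φ x : Euc (n + 1) →ₗ[ℝ] Euc m) := by
      ext i k
      have h3 := ((hasFDerivWithinAt_euclidean.1
        (hΦ'.hasFDerivAt.hasFDerivWithinAt (s := univ)) i).hasFDerivAt Filter.univ_mem).fderiv
      rw [Matrix.of_apply, h3]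
      simp [LinearMap.toMatrix_apply, e, e']
    rw [h2, ← LinearMap.toMatrix_comp, LinearMap.det_toMatrix, fderiv_comp x hΨ hΦ']
    rfl

/-- **Key step in the proof of the sharpness proposition.**
Suppose `f : S^n → ℝ^{2n+1}` admits a `C^1` map `Ψ : ℝ^{2n+1} → ℝ^{n+1}` with bounded
differential such that `Ψ ∘ f = id` on `S^n`, and `F ∈ W^{1,n+1}(B^{n+1},ℝ^{2n+1})`
has weak differential of rank `≤ n` a.e. Then there is no sequence `F_k`, `C^1` up to
the boundary, with `F_k → F` in `W^{1,n+1}`, `|{F_k ≠ F}| → 0`, and `F_k = f` on `S^n`. -/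
theorem no_rank_deficient_sobolev_extension (n : ℕ) (hn : 1 ≤ n)
    (f : Euc (n+1) → Euc (2*n+1))
    (M : ℝ) (hM : 0 < M) (Ψ : Euc (2*n+1) → Euc (n+1))
    (hΨ : ContDiff ℝ 1 Ψ) (hΨM : ∀ z, ‖fderiv ℝ Ψ z‖ ≤ M)
    (hΨf : ∀ x ∈ Metric.sphere (0 : Euc (n+1)) 1, Ψ (f x) = x)
    (F : Euc (n+1) → Euc (2*n+1)) (v : Fin (2*n+1) → Fin (n+1) → Euc (n+1) → ℝ)
    (hF : ∀ i, MemW1pWith (n+1) ((n : ℝ) + 1) (Metric.ball (0 : Euc (n+1)) 1)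
      (fun x => F x i) (fun k => v i k))
    (hrank : ∀ᵐ x ∂(volume.restrict (Metric.ball (0 : Euc (n+1)) 1)),
      (Matrix.of fun (i : Fin (2*n+1)) (k : Fin (n+1)) => v i k x).rank ≤ n) :
    ¬ ∃ Fk : ℕ → Euc (n+1) → Euc (2*n+1),
        (∀ j, ∀ i : Fin (2*n+1),
          ContDiffOn ℝ 1 (fun x => Fk j x i) (Metric.closedBall (0 : Euc (n+1)) 1)) ∧
        (∀ i : Fin (2*n+1),
          Filter.Tendsto (fun j => eLpNorm (fun x => Fk j x i - F x i)
              (ENNReal.ofReal ((n : ℝ) + 1))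
              (volume.restrict (Metric.ball (0 : Euc (n+1)) 1)))
            Filter.atTop (nhds 0)) ∧
        (∀ i : Fin (2*n+1), ∀ k : Fin (n+1),
          Filter.Tendsto (fun j =>
              eLpNorm (fun x =>
                  fderiv ℝ (fun y => Fk j y i) x (EuclideanSpace.single k 1) - v i k x)
                (ENNReal.ofReal ((n : ℝ) + 1))
                (volume.restrict (Metric.ball (0 : Euc (n+1)) 1)))
            Filter.atTop (nhds 0)) ∧
        (Filter.Tendsto
          (fun j => volume {x ∈ Metric.ball (0 : Euc (n+1)) 1 | Fk j x ≠ F x})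
          Filter.atTop (nhds 0)) ∧
        (∀ j, ∀ x ∈ Metric.sphere (0 : Euc (n+1)) 1, Fk j x = f x) := by
  rintro ⟨Fk, hC1, -, hDF, -, hbd⟩
  set p : ENNReal := ENNReal.ofReal ((n : ℝ) + 1) with hp
  set μ := volume.restrict (ball (0 : Euc (n+1)) 1) with hμ
  have hp1 : 1 ≤ p := by
    rw [hp, ENNReal.one_le_ofReal]
    linarith [Nat.cast_nonneg (α := ℝ) n]
  let b : ℕ → Fin (2*n+1) → Fin (n+1) → Euc (n+1) → ℝ := fun j i k x =>
    fderiv ℝ (fun y => Fk j y i) x (EuclideanSpace.single k 1)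
  have hv : ∀ i k, MemLp (v i k) p μ := fun i k => ((hF i).2 k).1
  have hbm : ∀ j i k, AEStronglyMeasurable (fun x => b j i k x - v i k x) μ := fun j i k =>
    (measurable_fderiv_apply_const ℝ _ _).aestronglyMeasurable.sub (hv i k).1
  let d : ℕ → Euc (n+1) → ℝ := fun j x => ∑ i, ∑ k, |b j i k x - v i k x|
  let s : Euc (n+1) → ℝ := fun x => ∑ i, ∑ k, |v i k x|
  have hd : Filter.Tendsto (fun j => eLpNorm (d j) p μ) Filter.atTop (nhds 0) := by
    have := tendsto_eLpNorm_sum_abs_zero (ι := Fin (2*n+1) × Fin (n+1)) hp1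
      (g := fun j q x => b j q.1 q.2 x - v q.1 q.2 x) (fun j q => hbm j q.1 q.2)
      (fun q => hDF q.1 q.2)
    simpa only [Fintype.sum_prod_type] using this
  have hs : MemLp s p μ :=
    memLp_finsetSum _ fun i _ => memLp_finsetSum _ fun k _ => (hv i k).norm
  have hdm : ∀ j, AEStronglyMeasurable (d j) μ := fun j =>
    Finset.aestronglyMeasurable_fun_sum _ fun i _ =>
      Finset.aestronglyMeasurable_fun_sum _ fun k _ => (hbm j i k).norm
  obtain ⟨C, hC, hdet⟩ := exists_abs_det_mul_le_of_rank_le n (2*n+1) hM.le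
  have hbound : ∀ j, volume (ball (0 : Euc (n+1)) 1) ≤ ENNReal.ofReal C *
      (eLpNorm (d j) p μ * (eLpNorm (d j) p μ + eLpNorm s p μ) ^ n) := by
    intro j
    have hFC : ContDiffOn ℝ 1 (Fk j) (closedBall 0 1) := contDiffOn_euclidean.2 (hC1 j)
    have hGC : ContDiffOn ℝ 1 (Ψ ∘ Fk j) (closedBall 0 1) := hΨ.comp_contDiffOn hFC
    have hnhds : ∀ x ∈ ball (0 : Euc (n+1)) 1, closedBall (0 : Euc (n+1)) 1 ∈ nhds x :=
      fun x hx => mem_nhds_iff.2 ⟨ball 0 1, ball_subset_closedBall, isOpen_ball, hx⟩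
    have hvol := integral_det_one_add_fderiv_eq_volume_ball volume
      (h := fun x => (Ψ ∘ Fk j) x - x) (hGC.sub contDiffOn_id) (fun x hx => by
        rw [Function.comp_apply, hbd j x hx, hΨf x hx, sub_self])
    have hcongr : ∀ x ∈ ball (0 : Euc (n+1)) 1,
        (1 + fderiv ℝ (fun x => (Ψ ∘ Fk j) x - x) x).det = (fderiv ℝ (Ψ ∘ Fk j) x).det := by
      intro x hx
      have hGd := (hGC.contDiffAt (hnhds x hx)).differentiableAt one_ne_zero
      have hsub : fderiv ℝ (fun x => (Ψ ∘ Fk j) x - x) x = fderiv ℝ (Ψ ∘ Fk j) x - 1 :=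
        (hGd.hasFDerivAt.sub (hasFDerivAt_id x)).fderiv
      rw [hsub, add_sub_cancel]
    rw [setIntegral_congr_fun measurableSet_ball hcongr] at hvol
    have hpt : ∀ᵐ x ∂μ, ‖(fderiv ℝ (Ψ ∘ Fk j) x).det‖ₑ ≤
        ENNReal.ofReal C * (‖d j x‖ₑ * ‖d j x + s x‖ₑ ^ n) := by
      filter_upwards [hrank, ae_restrict_mem measurableSet_ball] with x hxr hx
      obtain ⟨A, hA, hAdet⟩ := exists_det_fderiv_comp_eq_det_mul (x := x) (Φ := Fk j)
        (hΨ.differentiable one_ne_zero _) (hΨM _)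
        (fun i => ((hC1 j i).contDiffAt (hnhds x hx)).differentiableAt one_ne_zero)
      have h1 := hdet A (Matrix.of fun i k => b j i k x) (Matrix.of fun i k => v i k x) hA hxr
      have h2 : (fderiv ℝ (Ψ ∘ Fk j) x).det = (A * Matrix.of fun i k => b j i k x).det := hAdet
      have hd0 : 0 ≤ d j x := by positivity
      have hs0 : 0 ≤ s x := by positivity
      rw [h2, Real.enorm_eq_ofReal_abs, Real.enorm_of_nonneg hd0,
        Real.enorm_of_nonneg (add_nonneg hd0 hs0), ← ENNReal.ofReal_pow (add_nonneg hd0 hs0),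
        ← ENNReal.ofReal_mul hd0, ← ENNReal.ofReal_mul hC]
      exact ENNReal.ofReal_le_ofReal h1
    have hvol' : volume (ball (0 : Euc (n+1)) 1) =
        ‖∫ x in ball (0 : Euc (n+1)) 1, (fderiv ℝ (Ψ ∘ Fk j) x).det‖ₑ := by
      rw [hvol, Real.enorm_of_nonneg measureReal_nonneg, ofReal_measureReal measure_ball_lt_top.ne]
    calc volume (ball (0 : Euc (n+1)) 1)
        ≤ ∫⁻ x, ‖(fderiv ℝ (Ψ ∘ Fk j) x).det‖ₑ ∂μ :=
          hvol'.trans_le (enorm_integral_le_lintegral_enorm _)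
      _ ≤ ∫⁻ x, ENNReal.ofReal C * (‖d j x‖ₑ * ‖d j x + s x‖ₑ ^ n) ∂μ := lintegral_mono_ae hpt
      _ = ENNReal.ofReal C * ∫⁻ x, ‖d j x‖ₑ * ‖d j x + s x‖ₑ ^ n ∂μ :=
          lintegral_const_mul' _ _ ENNReal.ofReal_ne_top
      _ ≤ _ := by
          gcongr
          refine (lintegral_enorm_mul_pow_le hn (hdm j) ((hdm j).add hs.1)).trans ?_
          gcongr
          exact eLpNorm_add_le (hdm j) hs.1 hp1
  have hlim : Filter.Tendsto (fun j => ENNReal.ofReal C *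
      (eLpNorm (d j) p μ * (eLpNorm (d j) p μ + eLpNorm s p μ) ^ n)) Filter.atTop (nhds 0) := by
    have h1 : Filter.Tendsto (fun j => (eLpNorm (d j) p μ + eLpNorm s p μ) ^ n) Filter.atTop
        (nhds ((0 + eLpNorm s p μ) ^ n)) :=
      ((ENNReal.continuous_pow n).tendsto _).comp (hd.add tendsto_const_nhds)
    have h2 : (0 + eLpNorm s p μ) ^ n ≠ ⊤ := by
      rw [zero_add]
      exact ENNReal.pow_ne_top hs.2.ne
    have h3 := ENNReal.Tendsto.const_mul (a := ENNReal.ofReal C)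
      (ENNReal.Tendsto.mul hd (Or.inr h2) h1 (Or.inr ENNReal.zero_ne_top))
      (Or.inr ENNReal.ofReal_ne_top)
    simpa using h3
  exact (measure_ball_pos volume (0 : Euc (n+1)) one_pos).not_ge
    (ge_of_tendsto' hlim hbound)

end
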